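/- arXiv:0905.1975 — 2 statements merged into one kernel-verified Lean document; each statement's English description precedes it below -/
import Mathlib

section
/- Let h, g : ℝ → ℝ be continuous with h(u) > 0 for all u, fix s > 0, and for τ < s set Γ(τ,s) = ∫_τ^s h(u)² du, Ã(τ) := −1/(2Γ(τ,s)) and B̃(τ) := c₁·Γ(τ,s)^{-3/2} for an arbitrary constant c₁. Suppose ψ¹ : (0,s) × (0,∞) → ℝ is continuously differentiable in τ and twice continuously differentiable in b and satisfies the forward Schrödinger equation with time-dependent linear potential ∂ψ¹/∂τ(τ,b) + g(τ)·b·ψ¹(τ,b) = (1/2) h(τ)² ∂²ψ¹/∂b²(τ,b). Then ψ(τ,b) := ψ¹(τ,b)·b·B̃(τ)·exp(Ã(τ)b²) satisfies ∂ψ/∂τ(τ,b) = −g(τ)·b·ψ(τ,b) + (1/2) h(τ)² ∂²ψ/∂b²(τ,b) − ∂/∂b [ h(τ)² (1/b − b/Γ(τ,s)) ψ(τ,b) ] on (0,s) × (0,∞). -/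
/-- The first and second derivatives of a `C²` function on an open set, as `HasDerivAt` facts. -/
theorem ContDiffOn.hasDerivAt_two {u : ℝ → ℝ} {S : Set ℝ} (hu : ContDiffOn ℝ 2 u S)
    (hS : IsOpen S) {x : ℝ} (hx : x ∈ S) :
    HasDerivAt u (deriv u x) x ∧ HasDerivAt (deriv u) (iteratedDeriv 2 u x) x := by
  have hux : ContDiffAt ℝ 2 u x := hu.contDiffAt (hS.mem_nhds hx)
  refine ⟨(hux.differentiableAt (by norm_num)).hasDerivAt, ?_⟩
  have hd : ContDiffOn ℝ 1 (deriv u) S :=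
    ((contDiffOn_succ_iff_deriv_of_isOpen (n := 1) hS).1
      (by simpa [one_add_one_eq_two] using hu)).2.2
  have hdx := ((hd.contDiffAt (hS.mem_nhds hx)).differentiableAt (by norm_num)).hasDerivAt
  rwa [iteratedDeriv_succ, iteratedDeriv_one]

/-- The derivative of an integral with respect to its lower endpoint. -/
theorem hasDerivAt_integral_sq_left {h : ℝ → ℝ} (hc : Continuous h) (s τ : ℝ) :
    HasDerivAt (fun t => ∫ u in t..s, (h u) ^ 2) (-(h τ) ^ 2) τ :=
  intervalIntegral.integral_hasDerivAt_left ((hc.pow 2).intervalIntegrable _ _)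
    (hc.pow 2).stronglyMeasurable.stronglyMeasurableAtFilter (hc.pow 2).continuousAt

/-- The derivative of `u(b) e^{Ab²}`. -/
theorem HasDerivAt.mul_exp_sq {u : ℝ → ℝ} {u' b : ℝ} (hu : HasDerivAt u u' b) (A : ℝ) :
    HasDerivAt (fun x => u x * Real.exp (A * x ^ 2))
      ((u' + 2 * A * b * u b) * Real.exp (A * b ^ 2)) b := by
  have hE : HasDerivAt (fun x => Real.exp (A * x ^ 2))
      (Real.exp (A * b ^ 2) * (A * (2 * b))) b := by
    simpa using (((hasDerivAt_id b).pow 2).const_mul A).exp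
  exact (hu.mul hE).congr_deriv (by ring)

/-- If `ψ1` on `(0,s) × (0,∞)` satisfies the forward Schrödinger equation
with time-dependent linear potential `∂ψ1/∂τ + g(τ)bψ1 = (1/2)h(τ)² ∂²ψ1/∂b²`, then
`ψ(τ,b) := ψ1(τ,b)·b·B̃(τ)·exp(Ã(τ)b²)`, with `Ã(τ) = −1/(2Γ(τ,s))`,
`B̃(τ) = c₁ Γ(τ,s)^{-3/2}` and `Γ(τ,s) = ∫_τ^s h(u)² du`, satisfies
`∂ψ/∂τ = −g(τ)bψ + (1/2)h(τ)² ∂²ψ/∂b² − ∂/∂b[h(τ)²(1/b − b/Γ(τ,s))ψ]` on `(0,s) × (0,∞)`. -/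
theorem schrodinger_to_forward_kolmogorov_with_killing
    (h g : ℝ → ℝ) (hc : Continuous h) (hgc : Continuous g) (hpos : ∀ u, 0 < h u)
    (s : ℝ) (hs : 0 < s) (c₁ : ℝ)
    (Atil Btil : ℝ → ℝ)
    (hA : ∀ τ, Atil τ = -(2 * ∫ u in τ..s, (h u) ^ 2)⁻¹)
    (hB : ∀ τ, Btil τ = c₁ * (∫ u in τ..s, (h u) ^ 2) ^ (-(3 : ℝ) / 2))
    (ψ1 : ℝ → ℝ → ℝ)
    (hreg_τ : ∀ b : ℝ, 0 < b → ContDiffOn ℝ 1 (fun τ => ψ1 τ b) (Set.Ioo 0 s))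
    (hreg_b : ∀ τ ∈ Set.Ioo (0 : ℝ) s, ContDiffOn ℝ 2 (fun b => ψ1 τ b) (Set.Ioi 0))
    (hpde : ∀ τ ∈ Set.Ioo (0 : ℝ) s, ∀ b : ℝ, 0 < b →
      deriv (fun τ' => ψ1 τ' b) τ + g τ * b * ψ1 τ b
        = (1 / 2) * (h τ) ^ 2 * iteratedDeriv 2 (fun b' => ψ1 τ b') b)
    (ψ : ℝ → ℝ → ℝ)
    (hψ : ∀ τ b, ψ τ b = ψ1 τ b * b * Btil τ * Real.exp (Atil τ * b ^ 2)) :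
    ∀ τ ∈ Set.Ioo (0 : ℝ) s, ∀ b : ℝ, 0 < b →
      deriv (fun τ' => ψ τ' b) τ
        = -(g τ * b * ψ τ b)
          + (1 / 2) * (h τ) ^ 2 * iteratedDeriv 2 (fun b' => ψ τ b') b
          - deriv (fun b' =>
              (h τ) ^ 2 * (1 / b' - b' / ∫ u in τ..s, (h u) ^ 2) * ψ τ b') b := by
  intro τ hτ b hb
  have hΓpos : 0 < ∫ u in τ..s, (h u) ^ 2 :=
    intervalIntegral.intervalIntegral_pos_of_pos ((hc.pow 2).intervalIntegrable _ _)
      (fun u => pow_pos (hpos u) 2) hτ.2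
  have hΓ := hasDerivAt_integral_sq_left hc s τ
  set G : ℝ := ∫ u in τ..s, (h u) ^ 2 with hG
  have hG0 : G ≠ 0 := hΓpos.ne'
  have hAτ : Atil τ = -(2 * G)⁻¹ := hA τ
  -- derivatives of the two time-dependent coefficients
  have hdA : HasDerivAt Atil (-(h τ) ^ 2 / (2 * G ^ 2)) τ := by
    rw [funext hA]
    refine ((hΓ.const_mul 2).inv (by positivity)).neg.congr_deriv ?_
    rw [← hG]
    field_simp
  have hdB : HasDerivAt Btil (3 * (h τ) ^ 2 / (2 * G) * Btil τ) τ := by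
    rw [hB τ, funext hB, ← hG]
    refine ((hΓ.rpow_const (Or.inl hG0)).const_mul c₁).congr_deriv ?_
    rw [← hG, Real.rpow_sub_one hG0]
    field_simp
  -- the time derivative of `ψ`
  have hdu : HasDerivAt (fun t => ψ1 t b) (deriv (fun t => ψ1 t b) τ) τ :=
    (((hreg_τ b hb).contDiffAt (isOpen_Ioo.mem_nhds hτ)).differentiableAt
      (by norm_num)).hasDerivAt
  have hdτ := ((hdu.mul_const b).mul hdB).mul (hdA.mul_const (b ^ 2)).exp
  have hψτ : (fun t => ψ t b) =
      ((fun t => ψ1 t b * b) * Btil) * fun t => Real.exp (Atil t * b ^ 2) :=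
    funext fun t => hψ t b
  rw [hψτ, hdτ.deriv]
  -- the space derivatives of `ψ`
  set u : ℝ → ℝ := fun x => ψ1 τ x
  have hreg : ∀ x, 0 < x → HasDerivAt u (deriv u x) x ∧
      HasDerivAt (deriv u) (iteratedDeriv 2 u x) x :=
    fun x hx => (hreg_b τ hτ).hasDerivAt_two isOpen_Ioi hx
  set A : ℝ := Atil τ
  set B : ℝ := Btil τ
  have hψb : (fun x => ψ τ x) = fun x => u x * x * B * Real.exp (A * x ^ 2) :=
    funext fun x => hψ τ x
  have hψ₁ : ∀ x, 0 < x → HasDerivAt (fun x => ψ τ x)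
      ((deriv u x * x * B + u x * B + 2 * A * x * (u x * x * B)) * Real.exp (A * x ^ 2)) x := by
    intro x hx
    rw [hψb]
    refine ((((hreg x hx).1.mul (hasDerivAt_id x)).mul_const B).mul_exp_sq A).congr_deriv ?_
    simp only [Pi.mul_apply, id]
    ring
  have hψ₂ : iteratedDeriv 2 (fun x => ψ τ x) b =
      (iteratedDeriv 2 u b * b * B + 2 * deriv u b * B + 2 * A * (deriv u b * b ^ 2 * B)
        + 4 * A * b * (u b * B)
        + 2 * A * b * (deriv u b * b * B + u b * B + 2 * A * b * (u b * b * B)))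
        * Real.exp (A * b ^ 2) := by
    rw [iteratedDeriv_succ, iteratedDeriv_one]
    have heq : deriv (fun x => ψ τ x) =ᶠ[nhds b] fun x =>
        (deriv u x * x * B + u x * B + 2 * A * x * (u x * x * B)) * Real.exp (A * x ^ 2) :=
      Filter.eventually_of_mem (isOpen_Ioi.mem_nhds hb) fun x hx => (hψ₁ x hx).deriv
    rw [heq.deriv_eq]
    obtain ⟨h₁, h₂⟩ := hreg b hb
    have hid := hasDerivAt_id' b
    have hp := (((h₂.mul hid).mul_const B).add (h₁.mul_const B)).add
      ((hid.const_mul (2 * A)).mul ((h₁.mul hid).mul_const B))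
    refine ((hp.mul_exp_sq A).congr_deriv ?_).deriv
    simp only [Pi.mul_apply, Pi.add_apply]
    ring
  have hflux : deriv (fun x => (h τ) ^ 2 * (1 / x - x / G) * ψ τ x) b =
      (h τ) ^ 2 * (-1 / b ^ 2 - 1 / G) * ψ τ b + (h τ) ^ 2 * (1 / b - b / G) *
      ((deriv u b * b * B + u b * B + 2 * A * b * (u b * b * B)) * Real.exp (A * b ^ 2)) := by
    have hid := hasDerivAt_id' b
    have hdrift : HasDerivAt (fun x => (h τ) ^ 2 * (1 / x - x / G))
        ((h τ) ^ 2 * (-1 / b ^ 2 - 1 / G)) b := by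
      simpa [one_div, neg_div] using
        ((hasDerivAt_inv hb.ne').sub (hid.div_const G)).const_mul ((h τ) ^ 2)
    exact (hdrift.mul (hψ₁ b hb)).deriv
  have hut : deriv (fun t => ψ1 t b) τ =
      (1 / 2) * (h τ) ^ 2 * iteratedDeriv 2 u b - g τ * b * u b :=
    eq_sub_of_add_eq (hpde τ hτ b hb)
  rw [hψ₂, hflux, hut, hψ τ b]
  simp only [Pi.mul_apply]
  change _ = -(g τ * b * (u b * b * B * Real.exp (A * b ^ 2))) + _ -
    ((h τ) ^ 2 * (-1 / b ^ 2 - 1 / G) * (u b * b * B * Real.exp (A * b ^ 2)) + _)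
  change ((_ * b * B + u b * b * _) * Real.exp (A * b ^ 2) + (u b * b * B) * _) = _
  generalize Real.exp (A * b ^ 2) = E
  rw [hAτ]
  field_simp
  ring
end

section
/- Let h, g : ℝ → ℝ be continuous with h(u) > 0 for all u, set γ(t) = ∫_0^t h(u)² du, let π be differentiable with π'(t) = g(t) and v differentiable with v'(t) = −h(t)² π(t). Define the absorbed heat kernel H̃(t',y;τ',z) := (2π(τ'−t'))^{-1/2}[exp(−(z−y)²/(2(τ'−t'))) − exp(−(z+y)²/(2(τ'−t')))] for t' < τ'. Fix τ' ∈ ℝ and z ∈ ℝ, and define G(t,a) := exp( π(t)·a − (1/2)∫_0^t h(u)² π(u)² du ) · H̃( γ(t), a + v(t); τ', z ). Then G satisfies the backward Schrödinger equation with time-dependent linear potential −∂G/∂t(t,a) + g(t)·a·G(t,a) = (1/2) h(t)² ∂²G/∂a²(t,a) at every (t,a) with γ(t) < τ'. -/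
/-- The heat kernel `K(σ, w) = (2πσ)^{-1/2} exp(−w²/(2σ))`. -/
noncomputable def heatKernel (σ w : ℝ) : ℝ :=
  (Real.sqrt (2 * Real.pi * σ))⁻¹ * Real.exp (-w ^ 2 / (2 * σ))

/-- The derivative of the heat kernel along a differentiable curve. -/
theorem hasDerivAt_heatKernel_comp {σ w : ℝ → ℝ} {σ' w' t : ℝ} (hσ : HasDerivAt σ σ' t)
    (hw : HasDerivAt w w' t) (hpos : 0 < σ t) :
    HasDerivAt (fun s => heatKernel (σ s) (w s))
      (((1 / 2) * ((w t) ^ 2 / (σ t) ^ 2 - 1 / σ t) * σ' - w t / σ t * w') *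
        heatKernel (σ t) (w t)) t := by
  have hc : 0 < 2 * Real.pi * σ t := by positivity
  have hsqrt : 0 < Real.sqrt (2 * Real.pi * σ t) := Real.sqrt_pos.2 hc
  have h₁ := ((hσ.const_mul (2 * Real.pi)).sqrt hc.ne').fun_inv hsqrt.ne'
  have h₂ := ((hw.fun_pow 2).fun_neg.fun_div (hσ.const_mul 2) (by positivity)).exp
  refine (h₁.fun_mul h₂).congr_deriv ?_
  have hsq := Real.sq_sqrt hc.le
  unfold heatKernel
  rw [hsq]
  field_simp
  ring

/-- The derivative of the heat kernel in the space variable. -/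
theorem hasDerivAt_heatKernel_right {σ : ℝ} (hσ : 0 < σ) {w : ℝ → ℝ} {w' a : ℝ}
    (hw : HasDerivAt w w' a) :
    HasDerivAt (fun x => heatKernel σ (w x)) (-(w a / σ * w') * heatKernel σ (w a)) a :=
  (hasDerivAt_heatKernel_comp (hasDerivAt_const a σ) hw hσ).congr_deriv (by ring)

/-- The second space derivative of an exponentially tilted absorbed heat kernel. -/
theorem iteratedDeriv_two_exp_mul_absorbed_heatKernel {σ : ℝ} (hσ : 0 < σ) (p c v z a : ℝ) :
    iteratedDeriv 2 (fun x => Real.exp (p * x - c) *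
        (heatKernel σ (z - (x + v)) - heatKernel σ (z + (x + v)))) a =
      Real.exp (p * a - c) *
        ((p ^ 2 + 2 * p * ((z - (a + v)) / σ) + ((z - (a + v)) ^ 2 / σ ^ 2 - 1 / σ)) *
            heatKernel σ (z - (a + v))
          - (p ^ 2 - 2 * p * ((z + (a + v)) / σ) + ((z + (a + v)) ^ 2 / σ ^ 2 - 1 / σ)) *
            heatKernel σ (z + (a + v))) := by
  have hE (x : ℝ) : HasDerivAt (fun x => Real.exp (p * x - c))
      (Real.exp (p * x - c) * p) x := by
    simpa using (((hasDerivAt_id x).const_mul p).sub_const c).exp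
  have hm (x : ℝ) : HasDerivAt (fun x => z - (x + v)) (-1) x :=
    ((hasDerivAt_id x).add_const v).const_sub z
  have hq (x : ℝ) : HasDerivAt (fun x => z + (x + v)) 1 x :=
    ((hasDerivAt_id x).add_const v).const_add z
  have h₁ : deriv (fun x => Real.exp (p * x - c) *
        (heatKernel σ (z - (x + v)) - heatKernel σ (z + (x + v)))) =
      fun x => Real.exp (p * x - c) *
        ((p + (z - (x + v)) / σ) * heatKernel σ (z - (x + v))
          - (p - (z + (x + v)) / σ) * heatKernel σ (z + (x + v))) := by
    funext x
    refine (((hE x).fun_mul ((hasDerivAt_heatKernel_right hσ (hm x)).fun_sub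
      (hasDerivAt_heatKernel_right hσ (hq x)))).congr_deriv ?_).deriv
    ring
  rw [iteratedDeriv_succ, iteratedDeriv_one, h₁]
  refine (((hE a).fun_mul
    (((((hm a).div_const σ).const_add p).fun_mul (hasDerivAt_heatKernel_right hσ (hm a))).fun_sub
      ((((hq a).div_const σ).const_sub p).fun_mul
        (hasDerivAt_heatKernel_right hσ (hq a))))).congr_deriv ?_).deriv
  ring

/-- With `γ(t) = ∫_0^t h(u)² du`, `π'(t) = g(t)`, `v'(t) = −h(t)²π(t)`, and the
absorbed heat kernel
`H̃(t',y;τ',z) = (2π(τ'−t'))^{-1/2}[exp(−(z−y)²/(2(τ'−t'))) − exp(−(z+y)²/(2(τ'−t')))]`,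
the Green's function
`G(t,a) = exp(π(t)a − (1/2)∫_0^t h(u)²π(u)² du)·H̃(γ(t), a + v(t); τ', z)`
satisfies the backward Schrödinger equation with time-dependent linear potential
`−∂G/∂t + g(t)aG = (1/2)h(t)² ∂²G/∂a²` at every `(t,a)` with `γ(t) < τ'`. -/
theorem greens_function_backward_schrodinger
    (h g : ℝ → ℝ) (hc : Continuous h) (hgc : Continuous g) (hpos : ∀ u, 0 < h u)
    (γ : ℝ → ℝ) (hγ : ∀ t, γ t = ∫ u in (0:ℝ)..t, (h u) ^ 2)
    (p v : ℝ → ℝ)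
    (hp : ∀ t, HasDerivAt p (g t) t)
    (hv : ∀ t, HasDerivAt v (-(h t) ^ 2 * p t) t)
    (Htil : ℝ → ℝ → ℝ → ℝ → ℝ)
    (hHtil : ∀ t' y τ' z, t' < τ' → Htil t' y τ' z =
      (Real.sqrt (2 * Real.pi * (τ' - t')))⁻¹ *
        (Real.exp (-(z - y) ^ 2 / (2 * (τ' - t')))
          - Real.exp (-(z + y) ^ 2 / (2 * (τ' - t')))))
    (τ' z : ℝ)
    (G : ℝ → ℝ → ℝ)
    (hG : ∀ t a, G t a =
      Real.exp (p t * a - (1 / 2) * ∫ u in (0:ℝ)..t, (h u) ^ 2 * (p u) ^ 2) *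
        Htil (γ t) (a + v t) τ' z) :
    ∀ t a : ℝ, γ t < τ' →
      -deriv (fun t'' => G t'' a) t + g t * a * G t a
        = (1 / 2) * (h t) ^ 2 * iteratedDeriv 2 (fun a' => G t a') a := by
  intro t a ht
  have hpc : Continuous p := continuous_iff_continuousAt.2 fun s => (hp s).continuousAt
  have hγ' : HasDerivAt γ ((h t) ^ 2) t := by
    rw [funext hγ]
    exact (hc.pow 2).integral_hasStrictDerivAt 0 t |>.hasDerivAt
  have hI : HasDerivAt (fun s => ∫ u in (0:ℝ)..s, (h u) ^ 2 * (p u) ^ 2)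
      ((h t) ^ 2 * (p t) ^ 2) t :=
    ((hc.pow 2).mul (hpc.pow 2)).integral_hasStrictDerivAt 0 t |>.hasDerivAt
  have hform (s x : ℝ) (hs : γ s < τ') : G s x =
      Real.exp (p s * x - (1 / 2) * ∫ u in (0:ℝ)..s, (h u) ^ 2 * (p u) ^ 2) *
        (heatKernel (τ' - γ s) (z - (x + v s)) - heatKernel (τ' - γ s) (z + (x + v s))) := by
    rw [hG, hHtil _ _ _ _ hs]
    unfold heatKernel
    ring
  have hσ : 0 < τ' - γ t := sub_pos.2 ht
  have hev : (fun s => G s a) =ᶠ[nhds t] fun s =>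
      Real.exp (p s * a - (1 / 2) * ∫ u in (0:ℝ)..s, (h u) ^ 2 * (p u) ^ 2) *
        (heatKernel (τ' - γ s) (z - (a + v s)) - heatKernel (τ' - γ s) (z + (a + v s))) :=
    (hγ'.continuousAt.eventually_lt_const ht).mono fun s hs => hform s a hs
  have hE := (((hp t).mul_const a).fun_sub (hI.const_mul (1 / 2))).exp
  have hm := hasDerivAt_heatKernel_comp (hγ'.const_sub τ') (((hv t).const_add a).const_sub z) hσ
  have hq := hasDerivAt_heatKernel_comp (hγ'.const_sub τ') (((hv t).const_add a).const_add z) hσ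
  rw [hform t a ht, hev.deriv_eq, (hE.fun_mul (hm.fun_sub hq)).deriv,
    funext fun x => hform t x ht, iteratedDeriv_two_exp_mul_absorbed_heatKernel hσ]
  ring
end
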